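/- Let R be a Noetherian ring with nilradical N, and let P = ∩{ p : p ∈ Λ(R) }. If R is right Krull homogeneous and N is a right weakly ideal invariant ideal of R, then N = P. -/

import Mathlib

universe u v

/-- `DevLE α P`: the deviation (in the sense of Gabriel–Rentschler) of the
preordered set `P` exists and is at most the ordinal `α`. -/
def DevLE (α : Ordinal.{u}) (P : Type v) [Preorder P] : Prop :=
  ∀ f : ℕ → P, (∀ n, f (n + 1) ≤ f n) →
    ∃ N : ℕ, ∀ n, N ≤ n →
      (∀ x y : {z : P // f (n + 1) ≤ z ∧ z ≤ f n}, x ≤ y → y ≤ x) ∨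
      ∃ β : Ordinal.{u}, ∃ _ : β < α, DevLE β {z : P // f (n + 1) ≤ z ∧ z ≤ f n}
termination_by α

/-- The Gabriel–Rentschler Krull dimension of the `R`-module `M`. -/
noncomputable def kdim (R : Type u) (M : Type v) [Ring R] [AddCommGroup M] [Module R M] :
    WithBot Ordinal.{v} :=
  letI := Classical.propDecidable
  if Subsingleton M then ⊥
  else ↑(sInf {α : Ordinal.{v} | DevLE α (Submodule R M)})

/-- The right Krull dimension `|R|_r` of the ring `R`. -/
noncomputable def rKdim (R : Type u) [Ring R] : WithBot Ordinal.{u} := kdim Rᵐᵒᵖ R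

/-- The left Krull dimension `|R|_l` of the ring `R`. -/
noncomputable def lKdim (R : Type u) [Ring R] : WithBot Ordinal.{u} := kdim R R

/-- A two-sided ideal, viewed as a right ideal (i.e. an `Rᵐᵒᵖ`-submodule of `R`). -/
def TwoSidedIdeal.rightIdeal {R : Type u} [Ring R] (I : TwoSidedIdeal R) :
    Submodule Rᵐᵒᵖ R where
  carrier := I
  add_mem' := I.add_mem
  zero_mem' := I.zero_mem
  smul_mem' := fun c x hx => I.mul_mem_right x c.unop hx

/-- A two-sided ideal, viewed as a left ideal. -/
def TwoSidedIdeal.leftIdeal {R : Type u} [Ring R] (I : TwoSidedIdeal R) :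
    Submodule R R := TwoSidedIdeal.asIdeal I

/-- The quotient ring of `R` by the two-sided ideal `I`. -/
abbrev TwoSidedIdeal.Quot {R : Type u} [Ring R] (I : TwoSidedIdeal R) : Type u :=
  I.ringCon.Quotient

/-- A prime (two-sided) ideal of a possibly noncommutative ring:  a proper ideal `P`
such that `x R y ⊆ P` implies `x ∈ P` or `y ∈ P`. -/
def IsPrimeTS {R : Type u} [Ring R] (P : TwoSidedIdeal R) : Prop :=
  P ≠ ⊤ ∧ ∀ x y : R, (∀ r : R, x * r * y ∈ P) → x ∈ P ∨ y ∈ P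

/-- A semiprime ideal is an intersection of prime ideals. -/
def IsSemiprimeTS {R : Type u} [Ring R] (I : TwoSidedIdeal R) : Prop :=
  ∃ S : Set (TwoSidedIdeal R), (∀ p ∈ S, IsPrimeTS p) ∧ I = sInf S

/-- The nilradical (prime radical) of a ring: the intersection of all prime ideals. -/
noncomputable def nilradicalTS (R : Type u) [Ring R] : TwoSidedIdeal R :=
  sInf {P : TwoSidedIdeal R | IsPrimeTS P}

/-- `Λ(R)`: the set of prime ideals `p` with `|R/p|_r = |R|_r`. -/
noncomputable def Lam (R : Type u) [Ring R] : Set (TwoSidedIdeal R) :=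
  {p | IsPrimeTS p ∧ rKdim p.Quot = rKdim R}

/-- `Λ'(R)`: the set of prime ideals `q` with `|R/q|_l = |R|_l`. -/
noncomputable def Lam' (R : Type u) [Ring R] : Set (TwoSidedIdeal R) :=
  {p | IsPrimeTS p ∧ lKdim p.Quot = lKdim R}

/-- `A(R)`: the sum of all right ideals `I` of `R` with `|I|_r < |R|_r`. -/
noncomputable def AIdeal (R : Type u) [Ring R] : Submodule Rᵐᵒᵖ R :=
  sSup {I : Submodule Rᵐᵒᵖ R | kdim Rᵐᵒᵖ I < rKdim R}

/-- `B(R)`: the sum of all left ideals `K` of `R` with `|K|_l < |R|_l`. -/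
noncomputable def BIdeal (R : Type u) [Ring R] : Submodule R R :=
  sSup {K : Submodule R R | kdim R K < lKdim R}

/-- A ring is right Krull homogeneous if every nonzero right ideal has right Krull
dimension equal to that of the ring. -/
noncomputable def RightKrullHomogeneous (R : Type u) [Ring R] : Prop :=
  ∀ J : Submodule Rᵐᵒᵖ R, J ≠ ⊥ → kdim Rᵐᵒᵖ J = rKdim R

/-- A ring is left Krull homogeneous if every nonzero left ideal has left Krull
dimension equal to that of the ring. -/
noncomputable def LeftKrullHomogeneous (R : Type u) [Ring R] : Prop :=
  ∀ J : Submodule R R, J ≠ ⊥ → kdim R J = lKdim R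

/-- The two-sided ideal `I` is right weakly ideal invariant: for every right ideal `J`
with `|R/J|_r < |R/I|_r` one has `|I/JI|_r < |R/I|_r`. -/
noncomputable def RightWII (R : Type u) [Ring R] (I : TwoSidedIdeal R) : Prop :=
  ∀ J : Submodule Rᵐᵒᵖ R,
    kdim Rᵐᵒᵖ (R ⧸ J) < kdim Rᵐᵒᵖ (R ⧸ I.rightIdeal) →
    kdim Rᵐᵒᵖ (I.rightIdeal ⧸ (Submodule.comap I.rightIdeal.subtype
      (Submodule.span Rᵐᵒᵖ {x : R | ∃ j ∈ J, ∃ i ∈ I, x = j * i}))) <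
      kdim Rᵐᵒᵖ (R ⧸ I.rightIdeal)

/-- The two-sided ideal `I` is left weakly ideal invariant: for every left ideal `J`
with `|R/J|_l < |R/I|_l` one has `|I/IJ|_l < |R/I|_l`. -/
noncomputable def LeftWII (R : Type u) [Ring R] (I : TwoSidedIdeal R) : Prop :=
  ∀ J : Submodule R R,
    kdim R (R ⧸ J) < kdim R (R ⧸ I.leftIdeal) →
    kdim R (I.leftIdeal ⧸ (Submodule.comap I.leftIdeal.subtype
      (Submodule.span R {x : R | ∃ i ∈ I, ∃ j ∈ J, x = i * j}))) <
      kdim R (R ⧸ I.leftIdeal)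

/-- `C(I)`: the set of elements of `R` whose image in `R/I` is regular. -/
def Creg {R : Type u} [Ring R] (I : TwoSidedIdeal R) : Set R :=
  {c | ∀ x : R, (c * x ∈ I → x ∈ I) ∧ (x * c ∈ I → x ∈ I)}

/-- The ideal `I` is right localizable: `C(I)` satisfies the right Ore condition. -/
def RightLocalizable {R : Type u} [Ring R] (I : TwoSidedIdeal R) : Prop :=
  ∀ c ∈ Creg I, ∀ x : R, ∃ d ∈ Creg I, ∃ y : R, x * d = c * y

/-- The ideal `I` is left localizable: `C(I)` satisfies the left Ore condition. -/
def LeftLocalizable {R : Type u} [Ring R] (I : TwoSidedIdeal R) : Prop :=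
  ∀ c ∈ Creg I, ∀ x : R, ∃ d ∈ Creg I, ∃ y : R, d * x = y * c

/-- A finitely generated module is critical if `|M/M'| < |M|` for every nonzero
submodule `M'` of `M`. -/
noncomputable def IsCritical (R : Type u) (M : Type v) [Ring R] [AddCommGroup M]
    [Module R M] : Prop :=
  ∀ M' : Submodule R M, M' ≠ ⊥ → kdim R (M ⧸ M') < kdim R M

/-- `P` is a prime ideal associated to the right `R`-module `M`:  `M` contains a nonzero
submodule `N'` such that `P` is the annihilator of every nonzero submodule of `N'`. -/
def IsAssPrime {R : Type u} [Ring R] (P : TwoSidedIdeal R) (M : Type v) [AddCommGroup M]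
    [Module Rᵐᵒᵖ M] : Prop :=
  IsPrimeTS P ∧ ∃ N' : Submodule Rᵐᵒᵖ M, N' ≠ ⊥ ∧
    ∀ N'' : Submodule Rᵐᵒᵖ M, N'' ≠ ⊥ → N'' ≤ N' →
      ∀ r : R, (r ∈ P ↔ ∀ x ∈ N'', (MulOpposite.op r) • x = 0)

/-- A ring satisfies the right large condition if `|R/J|_r < |R|_r` for every
essential right ideal `J`. -/
noncomputable def RightLargeCondition (R : Type u) [Ring R] : Prop :=
  ∀ J : Submodule Rᵐᵒᵖ R, (∀ K : Submodule Rᵐᵒᵖ R, K ≠ ⊥ → J ⊓ K ≠ ⊥) →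
    kdim Rᵐᵒᵖ (R ⧸ J) < rKdim R

section Deviation

theorem DevLE.mono {α β : Ordinal.{u}} (h : α ≤ β) {P : Type v} [Preorder P]
    (hP : DevLE α P) : DevLE β P := by
  rw [DevLE] at hP ⊢
  intro f hf
  obtain ⟨N, hN⟩ := hP f hf
  refine ⟨N, fun n hn => (hN n hn).imp_right ?_⟩
  rintro ⟨γ, hγ, h'⟩
  exact ⟨γ, hγ.trans_le h, h'⟩

theorem DevLE.of_trivial (α : Ordinal.{u}) {P : Type v} [Preorder P]
    (h : ∀ x y : P, x ≤ y → y ≤ x) : DevLE α P := by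
  rw [DevLE]
  exact fun f _ => ⟨0, fun n _ => Or.inl fun x y hxy => h x.1 y.1 hxy⟩

/-- Deviation does not increase along a monotone map that reflects strict inequalities
between comparable elements. -/
theorem DevLE.of_strictMono {α : Ordinal.{u}} {P Q : Type v} [Preorder P] [Preorder Q]
    (g : P → Q) (hg : Monotone g) (hs : ∀ x y, x ≤ y → g y ≤ g x → y ≤ x)
    (hQ : DevLE α Q) : DevLE α P := by
  induction α using WellFoundedLT.induction generalizing P Q with
  | ind α ih =>
    rw [DevLE] at hQ ⊢
    intro f hf
    obtain ⟨N, hN⟩ := hQ (g ∘ f) fun n => hg (hf n)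
    refine ⟨N, fun n hn => ?_⟩
    let g' : {z : P // f (n + 1) ≤ z ∧ z ≤ f n} →
        {z : Q // (g ∘ f) (n + 1) ≤ z ∧ z ≤ (g ∘ f) n} :=
      fun z => ⟨g z.1, hg z.2.1, hg z.2.2⟩
    rcases hN n hn with h | ⟨β, hβ, h⟩
    · exact Or.inl fun x y hxy => hs _ _ hxy (h (g' x) (g' y) (hg hxy))
    · exact Or.inr ⟨β, hβ, ih β hβ g' (fun x y hxy => hg hxy)
        (fun x y hxy h' => hs _ _ hxy h') h⟩

theorem DevLE.prod {α : Ordinal.{u}} {P Q : Type v} [Preorder P] [Preorder Q]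
    (hP : DevLE α P) (hQ : DevLE α Q) : DevLE α (P × Q) := by
  induction α using WellFoundedLT.induction generalizing P Q with
  | ind α ih =>
    rw [DevLE] at hP hQ ⊢
    intro f hf
    obtain ⟨N₁, h₁⟩ := hP (fun n => (f n).1) fun n => (hf n).1
    obtain ⟨N₂, h₂⟩ := hQ (fun n => (f n).2) fun n => (hf n).2
    refine ⟨max N₁ N₂, fun n hn => ?_⟩
    let g : {z : P × Q // f (n + 1) ≤ z ∧ z ≤ f n} →
        {z : P // (f (n + 1)).1 ≤ z ∧ z ≤ (f n).1} ×
        {z : Q // (f (n + 1)).2 ≤ z ∧ z ≤ (f n).2} :=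
      fun z => (⟨z.1.1, z.2.1.1, z.2.2.1⟩, ⟨z.1.2, z.2.1.2, z.2.2.2⟩)
    have key : ∀ β < α,
        DevLE β {z : P // (f (n + 1)).1 ≤ z ∧ z ≤ (f n).1} →
        DevLE β {z : Q // (f (n + 1)).2 ≤ z ∧ z ≤ (f n).2} →
        DevLE β {z : P × Q // f (n + 1) ≤ z ∧ z ≤ f n} := fun β hβ h h' =>
      DevLE.of_strictMono g (fun x y hxy => Prod.mk_le_mk.2 ⟨hxy.1, hxy.2⟩)
        (fun x y _ hyx => ⟨(Prod.mk_le_mk.1 hyx).1, (Prod.mk_le_mk.1 hyx).2⟩) (ih β hβ h h')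
    rcases h₁ n (le_trans (le_max_left _ _) hn) with h | ⟨β, hβ, h⟩ <;>
      rcases h₂ n (le_trans (le_max_right _ _) hn) with h' | ⟨γ, hγ, h'⟩
    · exact Or.inl fun x y hxy =>
        ⟨h (g x).1 (g y).1 hxy.1, h' (g x).2 (g y).2 hxy.2⟩
    · exact Or.inr ⟨γ, hγ, key γ hγ (.of_trivial γ h) h'⟩
    · exact Or.inr ⟨β, hβ, key β hβ h (.of_trivial β h')⟩
    · exact Or.inr ⟨max β γ, max_lt hβ hγ, key _ (max_lt hβ hγ)
        (h.mono (le_max_left _ _)) (h'.mono (le_max_right _ _))⟩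

theorem exists_devLE_Ici {P : Type v} [PartialOrder P] [WellFoundedGT P] (x : P) :
    ∃ α : Ordinal.{v}, DevLE α (Set.Ici x) := by
  induction x using WellFoundedGT.induction with
  | ind x ih =>
    choose a ha using ih
    let α : Ordinal.{v} := ⨆ y : Set.Ioi x, Order.succ (a y.1 y.2)
    have hlt : ∀ y : Set.Ioi x, a y.1 y.2 < α := fun y =>
      (Order.lt_succ _).trans_le
        (Ordinal.le_iSup (fun y : Set.Ioi x => Order.succ (a y.1 y.2)) y)
    refine ⟨α, ?_⟩
    rw [DevLE]
    intro f hf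
    by_cases hx : ∃ n, (f n).1 = x
    · obtain ⟨N, hN⟩ := hx
      refine ⟨N, fun n hn => Or.inl fun y z _ => ?_⟩
      have h₁ : f n ≤ f N := antitone_nat_of_succ_le hf hn
      have h₂ : z.1.1 ≤ x := le_trans (show z.1.1 ≤ (f n).1 from z.2.2)
        (le_trans (show (f n).1 ≤ (f N).1 from h₁) hN.le)
      exact show z.1.1 ≤ y.1.1 from le_trans h₂ y.1.2
    · push Not at hx
      refine ⟨0, fun n _ => Or.inr ?_⟩
      have hn : x < (f (n + 1)).1 := lt_of_le_of_ne (f (n + 1)).2 (hx (n + 1)).symm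
      refine ⟨a _ hn, hlt ⟨_, hn⟩, ?_⟩
      exact DevLE.of_strictMono
        (fun z => (⟨z.1.1, z.2.1⟩ : Set.Ici (f (n + 1)).1))
        (fun y z hyz => hyz) (fun y z _ h => h) (ha _ hn)

theorem exists_devLE (P : Type v) [PartialOrder P] [OrderBot P] [WellFoundedGT P] :
    ∃ α : Ordinal.{v}, DevLE α P := by
  obtain ⟨α, hα⟩ := exists_devLE_Ici (⊥ : P)
  exact ⟨α, DevLE.of_strictMono (fun z => (⟨z, bot_le⟩ : Set.Ici (⊥ : P)))
    (fun y z hyz => hyz) (fun y z _ h => h) hα⟩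

end Deviation

section KrullDimension

theorem kdim_of_subsingleton {R : Type u} {M : Type v} [Ring R] [AddCommGroup M] [Module R M]
    [h : Subsingleton M] : kdim R M = ⊥ := by
  simp [kdim, h]

theorem kdim_of_nontrivial {R : Type u} {M : Type v} [Ring R] [AddCommGroup M] [Module R M]
    [h : Nontrivial M] :
    kdim R M = ↑(sInf {α : Ordinal.{v} | DevLE α (Submodule R M)}) := by
  simp [kdim, not_subsingleton M]

theorem devLE_sInf (R : Type u) (M : Type v) [Ring R] [AddCommGroup M] [Module R M]
    [IsNoetherian R M] :
    DevLE (sInf {α : Ordinal.{v} | DevLE α (Submodule R M)}) (Submodule R M) :=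
  csInf_mem (s := {α : Ordinal.{v} | DevLE α (Submodule R M)}) (exists_devLE _)

theorem kdim_le_of_strictMono {R : Type u} {M M' : Type v} [Ring R]
    [AddCommGroup M] [Module R M] [AddCommGroup M'] [Module R M'] [IsNoetherian R M']
    (g : Submodule R M → Submodule R M') (hg : Monotone g)
    (hs : ∀ x y, x ≤ y → g y ≤ g x → y ≤ x) : kdim R M ≤ kdim R M' := by
  rcases subsingleton_or_nontrivial M with hM | hM
  · simp [kdim_of_subsingleton]
  rcases subsingleton_or_nontrivial M' with hM' | hM'
  · exact absurd (hs ⊥ ⊤ bot_le (Subsingleton.elim _ _).le) (by simp)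
  · rw [kdim_of_nontrivial, kdim_of_nontrivial, WithBot.coe_le_coe]
    exact csInf_le' (DevLE.of_strictMono g hg hs (devLE_sInf R M'))

theorem kdim_le_of_injective {R : Type u} {M M' : Type v} [Ring R]
    [AddCommGroup M] [Module R M] [AddCommGroup M'] [Module R M'] [IsNoetherian R M']
    (f : M →ₗ[R] M') (hf : Function.Injective f) : kdim R M ≤ kdim R M' :=
  kdim_le_of_strictMono (Submodule.map f) (fun _ _ h => Submodule.map_mono h)
    fun _ _ _ h => (Submodule.map_le_map_iff_of_injective hf _ _).1 h

theorem kdim_le_of_surjective {R : Type u} {M M' : Type v} [Ring R]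
    [AddCommGroup M] [Module R M] [AddCommGroup M'] [Module R M'] [IsNoetherian R M]
    (f : M →ₗ[R] M') (hf : Function.Surjective f) : kdim R M' ≤ kdim R M :=
  kdim_le_of_strictMono (Submodule.comap f) (fun _ _ h => Submodule.comap_mono h)
    fun _ _ _ h => (Submodule.comap_le_comap_iff_of_surjective hf).1 h

theorem kdim_le_max_ker {R : Type u} {M M' : Type v} [Ring R]
    [AddCommGroup M] [Module R M] [AddCommGroup M'] [Module R M'] [IsNoetherian R M]
    [IsNoetherian R M'] (f : M →ₗ[R] M') :
    kdim R M ≤ max (kdim R (LinearMap.ker f)) (kdim R M') := by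
  rcases subsingleton_or_nontrivial M with hM | hM
  · simp [kdim_of_subsingleton]
  rcases subsingleton_or_nontrivial M' with hM' | hM'
  · refine le_max_of_le_left (kdim_le_of_surjective (LinearMap.ker f).subtype fun x => ?_)
    exact ⟨⟨x, Subsingleton.elim _ _⟩, rfl⟩
  rcases subsingleton_or_nontrivial (LinearMap.ker f) with hK | hK
  · refine le_max_of_le_right (kdim_le_of_injective f ?_)
    rw [← LinearMap.ker_eq_bot]
    exact (Submodule.subsingleton_iff_eq_bot).1 hK
  · rw [kdim_of_nontrivial, kdim_of_nontrivial, kdim_of_nontrivial, ← WithBot.coe_max,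
      WithBot.coe_le_coe]
    refine csInf_le' (DevLE.of_strictMono
      (fun X => (X.comap (LinearMap.ker f).subtype, X.map f))
      (fun X Y h => Prod.mk_le_mk.2 ⟨Submodule.comap_mono h, Submodule.map_mono h⟩) ?_
      (DevLE.prod ((devLE_sInf R (LinearMap.ker f)).mono (le_max_left _ _))
        ((devLE_sInf R M').mono (le_max_right _ _))))
    intro X Y hXY h y hy
    obtain ⟨h₁, h₂⟩ := Prod.mk_le_mk.1 h
    obtain ⟨x, hx, hxy⟩ := h₂ (Submodule.mem_map_of_mem hy)
    have : (⟨y - x, by simp [hxy]⟩ : LinearMap.ker f) ∈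
        X.comap (LinearMap.ker f).subtype := h₁ (Y.sub_mem hy (hXY hx))
    simpa using X.add_mem this hx

end KrullDimension

section RightIdeals

variable {R : Type u} [Ring R]

theorem isNoetherian_op_self [IsNoetherianRing Rᵐᵒᵖ] : IsNoetherian Rᵐᵒᵖ R :=
  isNoetherian_of_linearEquiv
    ({ (MulOpposite.opAddEquiv (α := R)).symm with
        map_smul' := fun _ _ => rfl } : Rᵐᵒᵖ ≃ₗ[Rᵐᵒᵖ] R)

/-- The map `r ↦ m r` from `R` to a right `R`-module. -/
def orbitMap {M : Type v} [AddCommGroup M] [Module Rᵐᵒᵖ M] (m : M) : R →ₗ[Rᵐᵒᵖ] M where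
  toFun r := MulOpposite.op r • m
  map_add' r s := by simp [add_smul]
  map_smul' s r := by simp [← mul_smul]

@[simp]
theorem orbitMap_apply {M : Type v} [AddCommGroup M] [Module Rᵐᵒᵖ M] (m : M) (r : R) :
    orbitMap m r = MulOpposite.op r • m := rfl

/-- The right ideal `J` is dense if `|R/J|_r < |R|_r`. -/
def DenseRight (J : Submodule Rᵐᵒᵖ R) : Prop := kdim Rᵐᵒᵖ (R ⧸ J) < rKdim R

theorem DenseRight.of_ker_le [IsNoetherian Rᵐᵒᵖ R] {M : Type u} [AddCommGroup M]
    [Module Rᵐᵒᵖ M] [IsNoetherian Rᵐᵒᵖ M] (hM : kdim Rᵐᵒᵖ M < rKdim R) (f : R →ₗ[Rᵐᵒᵖ] M)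
    {J : Submodule Rᵐᵒᵖ R} (h : LinearMap.ker f ≤ J) : DenseRight J := by
  refine lt_of_le_of_lt (le_trans (kdim_le_of_surjective (Submodule.factor h) ?_)
    (kdim_le_of_injective ((LinearMap.ker f).liftQ f le_rfl) ?_)) hM
  · exact Submodule.factor_surjective h
  · rw [← LinearMap.ker_eq_bot]
    exact Submodule.ker_liftQ_eq_bot _ _ _ le_rfl

theorem DenseRight.mono [IsNoetherian Rᵐᵒᵖ R] {J K : Submodule Rᵐᵒᵖ R} (hJ : DenseRight J)
    (h : J ≤ K) : DenseRight K :=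
  DenseRight.of_ker_le hJ J.mkQ (by simpa using h)

theorem DenseRight.inf [IsNoetherian Rᵐᵒᵖ R] {J K : Submodule Rᵐᵒᵖ R} (hJ : DenseRight J)
    (hK : DenseRight K) : DenseRight (J ⊓ K) := by
  let f : (R ⧸ J ⊓ K) →ₗ[Rᵐᵒᵖ] R ⧸ J := Submodule.factor inf_le_left
  let g : (R ⧸ J ⊓ K) →ₗ[Rᵐᵒᵖ] R ⧸ K := Submodule.factor inf_le_right
  refine lt_of_le_of_lt (kdim_le_max_ker f) (max_lt (lt_of_le_of_lt ?_ hK) hJ)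
  refine kdim_le_of_injective (g ∘ₗ (LinearMap.ker f).subtype) ?_
  rw [← LinearMap.ker_eq_bot, LinearMap.ker_eq_bot']
  rintro ⟨x, hx⟩ hgx
  obtain ⟨r, rfl⟩ := Submodule.mkQ_surjective _ x
  have h₁ : r ∈ J := by simpa [f] using hx
  have h₂ : r ∈ K := by simpa [g] using hgx
  simp [h₁, h₂]

theorem denseRight_top [Nontrivial R] : DenseRight (⊤ : Submodule Rᵐᵒᵖ R) := by
  unfold DenseRight rKdim
  have : Subsingleton (R ⧸ (⊤ : Submodule Rᵐᵒᵖ R)) := Submodule.Quotient.subsingleton_iff.2 rfl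
  rw [kdim_of_subsingleton, kdim_of_nontrivial]
  exact WithBot.bot_lt_coe _

theorem RightKrullHomogeneous.eq_zero [IsNoetherian Rᵐᵒᵖ R] (h : RightKrullHomogeneous R)
    {J : Submodule Rᵐᵒᵖ R} (hJ : DenseRight J) {a : R} (ha : ∀ r ∈ J, a * r = 0) : a = 0 := by
  by_contra ha0
  have hne : Submodule.span Rᵐᵒᵖ {a} ≠ ⊥ := by simpa using ha0
  refine absurd (h _ hne) (ne_of_lt (lt_of_le_of_lt ?_ hJ))
  let m : Submodule.span Rᵐᵒᵖ {a} := ⟨a, Submodule.mem_span_singleton_self a⟩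
  refine kdim_le_of_surjective (J.liftQ (orbitMap m) fun r hr => ?_) ?_
  · ext
    simpa [m] using ha r hr
  · rintro ⟨x, hx⟩
    obtain ⟨c, rfl⟩ := Submodule.mem_span_singleton.1 hx
    exact ⟨J.mkQ c.unop, rfl⟩

theorem rKdim_quot (p : TwoSidedIdeal R) :
    rKdim p.Quot = kdim Rᵐᵒᵖ (R ⧸ p.rightIdeal) := by
  have hmk : ∀ r s : R, (r : p.Quot) = s ↔ p.rightIdeal.mkQ r = p.rightIdeal.mkQ s := by
    intro r s
    rw [RingCon.eq, TwoSidedIdeal.rel_iff, Submodule.mkQ_apply, Submodule.mkQ_apply,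
      Submodule.Quotient.eq]
    rfl
  have hsur : ∀ q : p.Quot, ∃ r : R, (r : p.Quot) = q := Quotient.exists_rep
  let g : Submodule p.Quotᵐᵒᵖ p.Quot → Submodule Rᵐᵒᵖ (R ⧸ p.rightIdeal) := fun X =>
    { carrier := {y | ∃ r : R, p.rightIdeal.mkQ r = y ∧ (r : p.Quot) ∈ X}
      zero_mem' := ⟨0, by simp, by simp⟩
      add_mem' := by
        rintro _ _ ⟨r, rfl, hr⟩ ⟨s, rfl, hs⟩
        exact ⟨r + s, by simp, by simpa using X.add_mem hr hs⟩
      smul_mem' := by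
        rintro c _ ⟨r, rfl, hr⟩
        exact ⟨r * c.unop, rfl, X.smul_mem (MulOpposite.op (c.unop : p.Quot)) hr⟩ }
  let g' : Submodule Rᵐᵒᵖ (R ⧸ p.rightIdeal) → Submodule p.Quotᵐᵒᵖ p.Quot := fun Y =>
    { carrier := {q | ∃ r : R, (r : p.Quot) = q ∧ p.rightIdeal.mkQ r ∈ Y}
      zero_mem' := ⟨0, by simp, by simp⟩
      add_mem' := by
        rintro _ _ ⟨r, rfl, hr⟩ ⟨s, rfl, hs⟩
        exact ⟨r + s, by simp, by simpa using Y.add_mem hr hs⟩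
      smul_mem' := by
        rintro c _ ⟨r, rfl, hr⟩
        obtain ⟨s, hs⟩ := hsur c.unop
        refine ⟨r * s, ?_, Y.smul_mem (MulOpposite.op s) hr⟩
        rw [← MulOpposite.op_unop c, ← hs]
        rfl }
  have hdev : {α : Ordinal.{u} | DevLE α (Submodule p.Quotᵐᵒᵖ p.Quot)} =
      {α : Ordinal.{u} | DevLE α (Submodule Rᵐᵒᵖ (R ⧸ p.rightIdeal))} := by
    ext α
    constructor
    · refine DevLE.of_strictMono g' (fun X Y h => ?_) fun X Y _ h => ?_
      · rintro _ ⟨r, rfl, hr⟩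
        exact ⟨r, rfl, h hr⟩
      · intro y hy
        obtain ⟨r, rfl⟩ := Submodule.mkQ_surjective _ y
        obtain ⟨s, hs, hsX⟩ := h ⟨r, rfl, hy⟩
        rwa [(hmk s r).1 hs] at hsX
    · refine DevLE.of_strictMono g (fun X Y h => ?_) fun X Y _ h => ?_
      · rintro _ ⟨r, rfl, hr⟩
        exact ⟨r, rfl, h hr⟩
      · intro y hy
        obtain ⟨r, rfl⟩ := hsur y
        obtain ⟨s, hs, hsX⟩ := h ⟨r, rfl, hy⟩
        rwa [(hmk s r).2 hs] at hsX
  have hsub : Subsingleton p.Quot ↔ Subsingleton (R ⧸ p.rightIdeal) := by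
    constructor <;> intro _ <;> refine ⟨fun a b => ?_⟩
    · obtain ⟨r, rfl⟩ := Submodule.mkQ_surjective _ a
      obtain ⟨s, rfl⟩ := Submodule.mkQ_surjective _ b
      exact (hmk r s).1 (Subsingleton.elim _ _)
    · obtain ⟨r, rfl⟩ := hsur a
      obtain ⟨s, rfl⟩ := hsur b
      exact (hmk r s).2 (Subsingleton.elim _ _)
  unfold rKdim kdim
  simp only [hdev]
  split_ifs <;> tauto

theorem denseRight_of_isPrimeTS [IsNoetherian Rᵐᵒᵖ R] {p : TwoSidedIdeal R}
    (hp : IsPrimeTS p) (hL : p ∉ Lam R) : DenseRight p.rightIdeal := by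
  refine lt_of_le_of_ne (kdim_le_of_surjective _ p.rightIdeal.mkQ_surjective) fun h => hL ?_
  exact ⟨hp, (rKdim_quot p).trans h⟩

theorem denseRight_sInf [IsNoetherian Rᵐᵒᵖ R] [Nontrivial R] (l : List (TwoSidedIdeal R))
    (s : Set (TwoSidedIdeal R)) (hl : ∀ p ∈ l, p ∈ s → DenseRight p.rightIdeal) :
    DenseRight (sInf {p | p ∈ l ∧ p ∈ s}).rightIdeal := by
  induction l with
  | nil =>
    refine denseRight_top.mono fun x _ => ?_
    exact (TwoSidedIdeal.mem_sInf (S := {p | p ∈ [] ∧ p ∈ s})).2 (by simp)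
  | cons p l ih =>
    have ih := ih fun q hq => hl q (List.mem_cons_of_mem _ hq)
    by_cases hp : p ∈ s
    · refine (ih.inf (hl p List.mem_cons_self hp)).mono fun x hx => ?_
      refine (TwoSidedIdeal.mem_sInf (S := {q | q ∈ p :: l ∧ q ∈ s})).2 fun q hq => ?_
      rcases List.mem_cons.1 hq.1 with rfl | h
      · exact hx.2
      · exact (TwoSidedIdeal.mem_sInf R).1 (show x ∈ sInf {p | p ∈ l ∧ p ∈ s} from hx.1) _ ⟨h, hq.2⟩
    · refine ih.mono fun x hx => ?_
      refine (TwoSidedIdeal.mem_sInf (S := {q | q ∈ p :: l ∧ q ∈ s})).2 fun q hq => ?_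
      rcases List.mem_cons.1 hq.1 with rfl | h
      · exact absurd hq.2 hp
      · exact (TwoSidedIdeal.mem_sInf R).1 (show x ∈ sInf {p | p ∈ l ∧ p ∈ s} from hx) _ ⟨h, hq.2⟩

end RightIdeals

section Products

variable {R : Type u} [Ring R]

/-- The additive group of a two-sided ideal, as a `ℤ`-submodule of the ring. -/
def TwoSidedIdeal.toInt (I : TwoSidedIdeal R) : Submodule ℤ R :=
  AddSubgroup.toIntSubmodule I.asIdeal.toAddSubgroup

@[simp]
theorem TwoSidedIdeal.mem_toInt {I : TwoSidedIdeal R} {x : R} : x ∈ I.toInt ↔ x ∈ I := by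
  simp [TwoSidedIdeal.toInt]

theorem IsPrimeTS.le_of_pow_le {p : TwoSidedIdeal R} (hp : IsPrimeTS p) {I : TwoSidedIdeal R}
    {n : ℕ} (h : I.toInt ^ n ≤ p.toInt) : I ≤ p := by
  by_contra hI
  obtain ⟨x, hxI, hxp⟩ := SetLike.not_le_iff_exists.1 hI
  induction n with
  | zero =>
    refine hp.1 (TwoSidedIdeal.one_mem_iff _ |>.1 ?_)
    simpa using h (by simpa using Submodule.one_le.1 (le_refl (1 : Submodule ℤ R)))
  | succ n ih =>
    refine ih fun y hy => ?_
    rw [TwoSidedIdeal.mem_toInt]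
    refine (hp.2 y x fun r => ?_).resolve_right hxp
    rw [mul_assoc, ← TwoSidedIdeal.mem_toInt]
    refine h ?_
    rw [pow_succ]
    exact Submodule.mul_mem_mul hy (by simpa using I.mul_mem_left r x hxI)

theorem exists_prod_isPrimeTS_le [IsNoetherianRing R] (I : TwoSidedIdeal R) :
    ∃ l : List (TwoSidedIdeal R), (∀ p ∈ l, IsPrimeTS p) ∧
      (l.map TwoSidedIdeal.toInt).prod ≤ I.toInt := by
  have : WellFoundedGT (TwoSidedIdeal R) :=
    StrictMono.wellFoundedGT (f := fun I : TwoSidedIdeal R => I.asIdeal)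
      (strictMono_of_le_iff_le fun I J => by simp [SetLike.le_def])
  induction I using WellFoundedGT.induction with
  | ind I ih =>
    by_cases hI : IsPrimeTS I
    · exact ⟨[I], by simpa using hI, by simp⟩
    by_cases htop : I = ⊤
    · exact ⟨[], by simp, fun x _ => by simp [htop]⟩
    simp only [IsPrimeTS, not_and, not_forall, not_or] at hI
    obtain ⟨x, y, hxy, hx, hy⟩ := hI htop
    let A : TwoSidedIdeal R := .mk' {a | ∀ r, a * r * y ∈ I} (by simp [I.zero_mem])
      (fun ha hb r => by simpa [add_mul] using I.add_mem (ha r) (hb r))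
      (fun ha r => by simpa using I.neg_mem (ha r))
      (fun {s a} ha r => by simpa [mul_assoc] using I.mul_mem_left s _ (ha r))
      (fun {a s} ha r => by simpa [mul_assoc] using ha (s * r))
    have hA : ∀ a, a ∈ A ↔ ∀ r, a * r * y ∈ I := fun a => TwoSidedIdeal.mem_mk' ..
    let B : TwoSidedIdeal R := .mk' {b | ∀ a ∈ A, a * b ∈ I} (by simp [I.zero_mem])
      (fun hb hc a ha => by simpa [mul_add] using I.add_mem (hb a ha) (hc a ha))
      (fun hb a ha => by simpa using I.neg_mem (hb a ha))
      (fun {s b} hb a ha => by simpa [mul_assoc] using hb (a * s) (A.mul_mem_right _ _ ha))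
      (fun {b s} hb a ha => by simpa [mul_assoc] using I.mul_mem_right _ s (hb a ha))
    have hB : ∀ b, b ∈ B ↔ ∀ a ∈ A, a * b ∈ I := fun b => TwoSidedIdeal.mem_mk' ..
    have hIA : I < A := by
      refine lt_of_le_of_ne (fun a ha => (hA a).2 fun r => ?_) fun h => hx ?_
      · exact I.mul_mem_right _ _ (I.mul_mem_right _ _ ha)
      · rw [h]
        exact (hA x).2 hxy
    have hIB : I < B := by
      refine lt_of_le_of_ne (fun b hb => (hB b).2 fun a _ => I.mul_mem_left _ _ hb)
        fun h => hy ?_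
      rw [h]
      exact (hB y).2 fun a ha => by simpa using (hA a).1 ha 1
    obtain ⟨l, hl, hlA⟩ := ih A hIA
    obtain ⟨m, hm, hmB⟩ := ih B hIB
    refine ⟨l ++ m, fun p hp => (List.mem_append.1 hp).elim (hl p) (hm p), ?_⟩
    rw [List.map_append, List.prod_append]
    refine (mul_le_mul' hlA hmB).trans (Submodule.mul_le.2 fun a ha b hb => ?_)
    simp only [TwoSidedIdeal.mem_toInt] at ha hb ⊢
    exact (hB b).1 hb a ha

theorem toInt_pow_length_le {I : TwoSidedIdeal R} {l : List (TwoSidedIdeal R)}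
    (h : ∀ p ∈ l, I ≤ p) : I.toInt ^ l.length ≤ (l.map TwoSidedIdeal.toInt).prod := by
  induction l with
  | nil => simp
  | cons p l ih =>
    rw [List.length_cons, pow_succ', List.map_cons, List.prod_cons]
    refine mul_le_mul' (fun x hx => ?_) (ih fun q hq => h q (List.mem_cons_of_mem _ hq))
    simpa using h p List.mem_cons_self (by simpa using hx)

theorem le_nilradicalTS_of_pow_eq_bot {I : TwoSidedIdeal R} {n : ℕ} (h : I.toInt ^ n = ⊥) :
    I ≤ nilradicalTS R :=
  le_sInf fun _ hp => IsPrimeTS.le_of_pow_le hp (h.trans_le bot_le)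

/-- The right ideal `(A : a) = {r | a r ∈ A}`, for an additive subgroup `A` stable under
right multiplication. -/
def rightColon (A : Submodule ℤ R) (hA : ∀ x ∈ A, ∀ r : R, x * r ∈ A) (a : R) :
    Submodule Rᵐᵒᵖ R where
  carrier := {r | a * r ∈ A}
  add_mem' hr hs := by simpa [mul_add] using A.add_mem hr hs
  zero_mem' := by simp
  smul_mem' c r hr := by simpa [mul_assoc] using hA _ hr c.unop

theorem toInt_pow_succ_mul_mem (I : TwoSidedIdeal R) (n : ℕ) :
    ∀ x ∈ I.toInt ^ (n + 1), ∀ r : R, x * r ∈ I.toInt ^ (n + 1) := by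
  intro x hx r
  rw [pow_succ] at hx ⊢
  induction hx using Submodule.mul_induction_on' with
  | mem_mul_mem y hy z hz =>
    rw [mul_assoc]
    exact Submodule.mul_mem_mul hy (by simpa using I.mul_mem_right _ r (by simpa using hz))
  | add y _ z _ hy hz => rw [add_mul]; exact Submodule.add_mem _ hy hz

end Products

section Homogeneous

variable {R : Type u} [Ring R] [IsNoetherian Rᵐᵒᵖ R]

theorem RightKrullHomogeneous.kdim_quotient_eq [Nontrivial R] (hkh : RightKrullHomogeneous R)
    {N : TwoSidedIdeal R} {n : ℕ} (hn : N.toInt ^ n = ⊥) :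
    kdim Rᵐᵒᵖ (R ⧸ N.rightIdeal) = rKdim R := by
  refine (kdim_le_of_surjective _ N.rightIdeal.mkQ_surjective).antisymm (not_lt.1 fun h => ?_)
  change DenseRight N.rightIdeal at h
  induction n with
  | zero =>
    have : (1 : R) ∈ (⊥ : Submodule ℤ R) := by
      rw [← hn, pow_zero]
      exact Submodule.one_le.1 le_rfl
    simp at this
  | succ n ih =>
    refine ih ((Submodule.eq_bot_iff _).2 fun a ha => hkh.eq_zero h fun r hr => ?_)
    have : a * r ∈ N.toInt ^ (n + 1) := by
      rw [pow_succ]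
      exact Submodule.mul_mem_mul ha (TwoSidedIdeal.mem_toInt.2 hr)
    simpa [hn] using this

/-- A weakly ideal invariant ideal `N` with `|R/N|_r = |R|_r` preserves density:
`(J N : a)` is dense whenever `J` is dense and `a ∈ N`. -/
theorem RightWII.exists_dense {N : TwoSidedIdeal R} (hwii : RightWII R N)
    (hN : kdim Rᵐᵒᵖ (R ⧸ N.rightIdeal) = rKdim R) {J : Submodule Rᵐᵒᵖ R} (hJ : DenseRight J)
    {a : R} (ha : a ∈ N) :
    ∃ K, DenseRight K ∧
      ∀ r ∈ K, a * r ∈ Submodule.span Rᵐᵒᵖ {x : R | ∃ j ∈ J, ∃ i ∈ N, x = j * i} := by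
  have h := hwii J (by rw [hN]; exact hJ)
  rw [hN] at h
  refine ⟨_, DenseRight.of_ker_le h (orbitMap (Submodule.Quotient.mk ⟨a, ha⟩)) le_rfl,
    fun r hr => ?_⟩
  rw [LinearMap.mem_ker, orbitMap_apply, ← Submodule.Quotient.mk_smul,
    Submodule.Quotient.mk_eq_zero] at hr
  exact hr

theorem RightWII.denseRight_rightColon {N P : TwoSidedIdeal R} (hwii : RightWII R N)
    (hN : kdim Rᵐᵒᵖ (R ⧸ N.rightIdeal) = rKdim R) {Q : Submodule Rᵐᵒᵖ R} (hQ : DenseRight Q)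
    (hPQ : ∀ a ∈ P, ∀ q ∈ Q, a * q ∈ N) (i : ℕ) {a : R} (ha : a ∈ P.toInt * N.toInt ^ i) :
    DenseRight (rightColon (N.toInt ^ (i + 1)) (toInt_pow_succ_mul_mem N i) a) := by
  induction i generalizing a with
  | zero =>
    refine hQ.mono fun q hq => ?_
    simpa [rightColon] using hPQ a (by simpa using ha) q hq
  | succ i ih =>
    rw [pow_succ, ← mul_assoc] at ha
    induction ha using Submodule.mul_induction_on' with
    | mem_mul_mem b hb n hn =>
      obtain ⟨K, hK, h⟩ := hwii.exists_dense hN (ih hb) (TwoSidedIdeal.mem_toInt.1 hn)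
      refine hK.mono fun r hr => ?_
      change b * n * r ∈ N.toInt ^ (i + 1 + 1)
      rw [mul_assoc]
      have hr := h r hr
      generalize n * r = z at hr ⊢
      induction hr using Submodule.span_induction with
      | mem x hx =>
        obtain ⟨j, hj, k, hk, rfl⟩ := hx
        rw [← mul_assoc, pow_succ]
        exact Submodule.mul_mem_mul hj (TwoSidedIdeal.mem_toInt.2 hk)
      | zero => simp
      | add x y _ _ hx hy => rw [mul_add]; exact Submodule.add_mem _ hx hy
      | smul c x _ hx =>
        simpa [mul_assoc] using toInt_pow_succ_mul_mem N _ _ hx c.unop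
    | add x _ y _ hx hy =>
      refine (hx.inf hy).mono fun r hr => ?_
      change (x + y) * r ∈ N.toInt ^ (i + 1 + 1)
      rw [add_mul]
      exact Submodule.add_mem _ hr.1 hr.2

theorem RightKrullHomogeneous.pow_eq_bot (hkh : RightKrullHomogeneous R)
    {N P : TwoSidedIdeal R} (hwii : RightWII R N)
    (hN : kdim Rᵐᵒᵖ (R ⧸ N.rightIdeal) = rKdim R) {Q : Submodule Rᵐᵒᵖ R} (hQ : DenseRight Q)
    (hPQ : ∀ a ∈ P, ∀ q ∈ Q, a * q ∈ N) (i j : ℕ) (h : P.toInt ^ j * N.toInt ^ i = ⊥) :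
    P.toInt ^ (j + i) = ⊥ := by
  induction i generalizing j with
  | zero => simpa using h
  | succ i ih =>
    rw [← add_assoc, add_right_comm]
    refine ih (j + 1) ?_
    rw [pow_succ, mul_assoc, eq_bot_iff, Submodule.mul_le]
    intro x hx y hy
    refine (Submodule.mem_bot ℤ).2
      (hkh.eq_zero (hwii.denseRight_rightColon hN hQ hPQ i hy) fun r hr => ?_)
    rw [mul_assoc, ← Submodule.mem_bot ℤ, ← h]
    exact Submodule.mul_mem_mul hx hr

end Homogeneous

/-- Let `R` be Noetherian with nilradical `N` and `P = ∩{ p : p ∈ Λ(R) }`.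
If `R` is right Krull homogeneous and `N` is right weakly ideal invariant, then
`N = P`. -/
theorem statement_13 (R : Type u) [Ring R] [IsNoetherianRing R] [IsNoetherianRing Rᵐᵒᵖ]
    (hkh : RightKrullHomogeneous R)
    (N : TwoSidedIdeal R) (hN : N = nilradicalTS R) (hwii : RightWII R N)
    (P : TwoSidedIdeal R) (hP : P = sInf (Lam R)) :
    N = P := by
  rcases subsingleton_or_nontrivial R with hR | hR
  · refine le_antisymm (fun x _ => ?_) fun x _ => ?_ <;> rw [Subsingleton.elim x 0]
    exacts [P.zero_mem, N.zero_mem]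
  have := isNoetherian_op_self (R := R)
  obtain ⟨l, hl, hprod⟩ := exists_prod_isPrimeTS_le (⊥ : TwoSidedIdeal R)
  have hpow : ∀ I : TwoSidedIdeal R, (∀ p ∈ l, I ≤ p) → I.toInt ^ l.length = ⊥ := by
    refine fun I hI => eq_bot_iff.2 ((toInt_pow_length_le hI).trans (hprod.trans fun x hx => ?_))
    simpa [TwoSidedIdeal.mem_bot] using hx
  have hNl : N.toInt ^ l.length = ⊥ := hpow N fun p hp => hN ▸ sInf_le (hl p hp)
  let Q : TwoSidedIdeal R := sInf {p | p ∈ l ∧ p ∈ (Lam R)ᶜ}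
  have hQ : DenseRight Q.rightIdeal :=
    denseRight_sInf l _ fun p hp hpL => denseRight_of_isPrimeTS (hl p hp) hpL
  have hPQ : ∀ a ∈ P, ∀ q ∈ Q.rightIdeal, a * q ∈ N := by
    intro a ha q hq
    rw [hN]
    refine le_nilradicalTS_of_pow_eq_bot (hpow (P ⊓ Q) fun p hp => ?_)
      ((TwoSidedIdeal.mem_inf R).2 ⟨P.mul_mem_right _ _ ha, Q.mul_mem_left _ _ hq⟩)
    by_cases hpL : p ∈ Lam R
    · exact inf_le_left.trans (hP ▸ sInf_le hpL)
    · exact inf_le_right.trans (sInf_le ⟨hp, hpL⟩)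
  refine le_antisymm ?_ ?_
  · rw [hN, hP]
    exact sInf_le_sInf fun p hp => hp.1
  · rw [hN]
    exact le_nilradicalTS_of_pow_eq_bot (hkh.pow_eq_bot hwii (hkh.kdim_quotient_eq hNl) hQ hPQ
      l.length 0 (by rw [hNl, Submodule.mul_bot]))
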